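/- Let H be a complex Hilbert space with dim H ≥ 2 and let φ: P(H) → P(H) be a surjective map such that ‖φ(P) − φ(Q)‖ ≤ ‖P − Q‖ for every pair P, Q ∈ P(H). Then φ is a Wigner symmetry. -/

import Mathlib

open scoped InnerProductSpace ComplexConjugate

variable {H : Type*} [NormedAddCommGroup H] [InnerProductSpace ℂ H] [CompleteSpace H]

/-- The rank-one (orthogonal) projection onto the span of a unit vector `v`,
i.e. `x ↦ ⟪v, x⟫ • v`. -/
noncomputable def rankOneProj (v : H) : H →L[ℂ] H :=
  (innerSL ℂ v).smulRight v

/-- A rank-one projection: a self-adjoint idempotent bounded operator with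
one-dimensional range. -/
def IsRankOneProjection (P : H →L[ℂ] H) : Prop :=
  IsSelfAdjoint P ∧ P ∘L P = P ∧ Module.finrank ℂ (LinearMap.range (P : H →ₗ[ℂ] H)) = 1

/-- `φ` is a Wigner symmetry: there is a unitary or antiunitary operator `U` on `H`
(an additive, norm-preserving, surjective map that is `ℂ`-linear or conjugate-linear)
such that `φ P = U P U*` for every rank-one projection `P`; equivalently, `φ` sends the
projection onto `ℂv` to the projection onto `ℂ(Uv)` for every unit vector `v`. -/
def IsWignerSymmetry
    (φ : {P : H →L[ℂ] H // IsRankOneProjection P} → {P : H →L[ℂ] H // IsRankOneProjection P}) :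
    Prop :=
  ∃ U : H → H,
    (∀ x y, U (x + y) = U x + U y) ∧
    (∀ x, ‖U x‖ = ‖x‖) ∧
    Function.Surjective U ∧
    ((∀ (c : ℂ) (x : H), U (c • x) = c • U x) ∨
      (∀ (c : ℂ) (x : H), U (c • x) = (starRingEnd ℂ) c • U x)) ∧
    (∀ (v : H), ‖v‖ = 1 → ∀ P : {P : H →L[ℂ] H // IsRankOneProjection P},
      P.1 = rankOneProj v → (φ P).1 = rankOneProj (U v))

set_option linter.unusedSectionVars false

/-- A norm-preserving map that does not decrease the modulus of inner products and is surjective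
up to phases: the vector form of a surjective nonexpansive map of rank-one projections. -/
structure OverlapIncreasing (F : H → H) : Prop where
  norm_map : ∀ v, ‖F v‖ = ‖v‖
  norm_inner_le : ∀ v w, ‖⟪v, w⟫_ℂ‖ ≤ ‖⟪F v, F w⟫_ℂ‖
  exists_phase : ∀ w, ∃ v, ∃ c : ℂ, ‖c‖ = 1 ∧ w = c • F v

/-- `w` agrees with `F v` up to a phase. -/
def PhaseRel (F : H → H) (v w : H) : Prop :=
  ∃ c : ℂ, ‖c‖ = 1 ∧ w = c • F v

lemma exists_phase_of_norm_le_inner {x w : H} (hn : ‖w‖ = ‖x‖) (h : ‖x‖ ^ 2 ≤ ‖⟪x, w⟫_ℂ‖) :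
    ∃ c : ℂ, ‖c‖ = 1 ∧ w = c • x := by
  by_cases hx : x = 0
  · subst hx
    refine ⟨1, by simp, ?_⟩
    simpa using hn
  have hw : w ≠ 0 := by
    intro h0
    rw [h0, norm_zero] at hn
    exact hx (norm_eq_zero.1 hn.symm)
  have heq : ‖⟪x, w⟫_ℂ‖ = ‖x‖ * ‖w‖ := by
    refine le_antisymm (norm_inner_le_norm x w) ?_
    rw [hn, ← sq]
    exact h
  obtain ⟨r, -, hr⟩ := (norm_inner_eq_norm_iff hx hw).1 heq
  refine ⟨r, ?_, hr⟩
  rw [hr, norm_smul] at hn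
  have : ‖x‖ ≠ 0 := norm_ne_zero_iff.2 hx
  exact mul_right_cancel₀ this (by rw [hn, one_mul])

namespace OverlapIncreasing

variable {F : H → H}

lemma rel_map (F : H → H) (v : H) : PhaseRel F v (F v) := ⟨1, by simp, by simp⟩

lemma rel_norm (hF : OverlapIncreasing F) {v w : H} (h : PhaseRel F v w) : ‖w‖ = ‖v‖ := by
  obtain ⟨c, hc, rfl⟩ := h
  rw [norm_smul, hc, one_mul, hF.norm_map]

lemma rel_inner_le (hF : OverlapIncreasing F) {v w v₂ w₂ : H} (h : PhaseRel F v w)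
    (h₂ : PhaseRel F v₂ w₂) : ‖⟪v, v₂⟫_ℂ‖ ≤ ‖⟪w, w₂⟫_ℂ‖ := by
  obtain ⟨c, hc, rfl⟩ := h
  obtain ⟨d, hd, rfl⟩ := h₂
  rw [inner_smul_left, inner_smul_right, norm_mul, norm_mul, RCLike.norm_conj, hc, hd, one_mul,
    one_mul]
  exact hF.norm_inner_le v v₂

lemma rel_surj (hF : OverlapIncreasing F) (w : H) : ∃ v, PhaseRel F v w := hF.exists_phase w

lemma rel_unique {v w w₂ : H} (h : PhaseRel F v w) (h₂ : PhaseRel F v w₂) :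
    ∃ c : ℂ, ‖c‖ = 1 ∧ w₂ = c • w := by
  obtain ⟨c, hc, rfl⟩ := h
  obtain ⟨d, hd, rfl⟩ := h₂
  have hc0 : c ≠ 0 := by
    rintro rfl
    simp at hc
  refine ⟨d * c⁻¹, by simp [hc, hd], ?_⟩
  rw [smul_smul, inv_mul_cancel_right₀ hc0]

lemma rel_of_inner (hF : OverlapIncreasing F) {v x w : H} (h : PhaseRel F v x)
    (hn : ‖w‖ = ‖v‖) (hi : ‖v‖ ^ 2 ≤ ‖⟪x, w⟫_ℂ‖) : PhaseRel F v w := by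
  obtain ⟨c, hc, rfl⟩ := exists_phase_of_norm_le_inner (x := x) (w := w)
    (by rw [hn, hF.rel_norm h]) (by rwa [hF.rel_norm h])
  obtain ⟨d, hd, rfl⟩ := h
  exact ⟨c * d, by simp [hc, hd], by rw [smul_smul]⟩

lemma rel_smul (hF : OverlapIncreasing F) {v w : H} (h : PhaseRel F v w) {c d : ℂ}
    (hcd : ‖d‖ = ‖c‖) : PhaseRel F (c • v) (d • w) := by
  have hw := hF.rel_norm h
  refine hF.rel_of_inner (rel_map F _) (by rw [norm_smul, norm_smul, hcd, hw]) ?_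
  have := hF.rel_inner_le (rel_map F (c • v)) h
  rw [inner_smul_left, norm_mul, RCLike.norm_conj, inner_self_eq_norm_sq_to_K] at this
  rw [inner_smul_right, norm_mul, hcd, norm_smul, mul_pow, sq ‖c‖, mul_assoc]
  refine mul_le_mul_of_nonneg_left (le_trans (le_of_eq ?_) this) (norm_nonneg _)
  simp

lemma orthogonal_of_rel (hF : OverlapIncreasing F) {v w v₂ w₂ : H} (h : PhaseRel F v w)
    (h₂ : PhaseRel F v₂ w₂) (hw : ⟪w, w₂⟫_ℂ = 0) : ⟪v, v₂⟫_ℂ = 0 := by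
  have := hF.rel_inner_le h h₂
  rw [hw, norm_zero] at this
  exact norm_le_zero_iff.1 this

section Family

variable {ι : Type*} {e' e : ι → H}

lemma orthonormal_of_rel (hF : OverlapIncreasing F) (he : Orthonormal ℂ e)
    (h : ∀ i, PhaseRel F (e' i) (e i)) : Orthonormal ℂ e' :=
  ⟨fun i => by rw [← hF.rel_norm (h i), he.1 i],
    fun i j hij => hF.orthogonal_of_rel (h i) (h j) (he.2 hij)⟩

lemma _root_.Orthonormal.norm_sum_smul_sq [Fintype ι] (he : Orthonormal ℂ e) (a : ι → ℂ) :
    ‖∑ i, a i • e i‖ ^ 2 = ∑ i, ‖a i‖ ^ 2 := by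
  have : ((‖∑ i, a i • e i‖ ^ 2 : ℝ) : ℂ) = ((∑ i, ‖a i‖ ^ 2 : ℝ) : ℂ) := by
    push_cast
    refine (inner_self_eq_norm_sq_to_K (𝕜 := ℂ) (∑ i, a i • e i)).symm.trans ?_
    rw [he.inner_sum]
    refine Finset.sum_congr rfl fun i _ => ?_
    rw [RCLike.conj_mul]
    rfl
  exact_mod_cast this

lemma rel_sum_coords [Fintype ι] (hF : OverlapIncreasing F) (he : Orthonormal ℂ e)
    (h : ∀ i, PhaseRel F (e' i) (e i)) {a : ι → ℂ} {v : H}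
    (hv : PhaseRel F (∑ i, a i • e' i) v) :
    ∃ b : ι → ℂ, v = ∑ i, b i • e i ∧ ∀ i, ‖b i‖ = ‖a i‖ := by
  have he' := hF.orthonormal_of_rel he h
  set b : ι → ℂ := fun i => ⟪e i, v⟫_ℂ with hb
  have hle : ∀ i, ‖a i‖ ^ 2 ≤ ‖b i‖ ^ 2 := fun i => by
    have := hF.rel_inner_le (h i) hv
    rw [he'.inner_right_fintype] at this
    exact pow_le_pow_left₀ (norm_nonneg _) this 2
  have hbessel : ∑ i, ‖b i‖ ^ 2 ≤ ‖v‖ ^ 2 := he.sum_inner_products_le v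
  have hnorm : ‖v‖ ^ 2 = ∑ i, ‖a i‖ ^ 2 := by
    rw [hF.rel_norm hv, he'.norm_sum_smul_sq]
  have hsum : ∑ i, ‖a i‖ ^ 2 = ∑ i, ‖b i‖ ^ 2 :=
    le_antisymm (Finset.sum_le_sum fun i _ => hle i) (hnorm ▸ hbessel)
  have heq := (Finset.sum_eq_sum_iff_of_le fun i _ => hle i).1 hsum
  refine ⟨b, ?_, fun i => ?_⟩
  · have hin : ⟪v, ∑ i, b i • e i⟫_ℂ = ((∑ i, ‖b i‖ ^ 2 : ℝ) : ℂ) := by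
      rw [inner_sum]
      push_cast
      refine Finset.sum_congr rfl fun i _ => ?_
      rw [inner_smul_right, hb, ← inner_conj_symm, RCLike.mul_conj]
      rfl
    have : ‖v - ∑ i, b i • e i‖ ^ 2 = 0 := by
      rw [norm_sub_sq (𝕜 := ℂ), hin, he.norm_sum_smul_sq, hnorm, hsum]
      simp only [RCLike.re_to_complex, Complex.ofReal_re]
      ring
    exact sub_eq_zero.1 (norm_eq_zero.1 (pow_eq_zero_iff two_ne_zero |>.1 this))
  · exact ((pow_left_inj₀ (norm_nonneg _) (norm_nonneg _) two_ne_zero).1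
      (heq i (Finset.mem_univ i))).symm

lemma norm_coeff_eq [Fintype ι] (hF : OverlapIncreasing F) (he : Orthonormal ℂ e)
    (h : ∀ i, PhaseRel F (e' i) (e i)) {a b : ι → ℂ}
    (hab : PhaseRel F (∑ i, a i • e' i) (∑ i, b i • e i)) (i : ι) : ‖b i‖ = ‖a i‖ := by
  obtain ⟨c, hc, hca⟩ := hF.rel_sum_coords he h hab
  have := congrArg (fun x => ⟪e i, x⟫_ℂ) hc
  simp only [he.inner_right_fintype] at this
  rw [this, hca]

/-- If `z i` are complex numbers with `∑ ‖z i‖ ≤ ‖∑ z i‖` then they share a common phase. -/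
lemma _root_.exists_common_phase [Fintype ι] (z : ι → ℂ) (h : ∑ i, ‖z i‖ ≤ ‖∑ i, z i‖) :
    ∃ θ : ℂ, ‖θ‖ = 1 ∧ ∀ i, z i = θ * ‖z i‖ := by
  obtain ⟨θ, hθ, hs⟩ : ∃ θ : ℂ, ‖θ‖ = 1 ∧ ∑ i, z i = θ * ‖∑ i, z i‖ := by
    refine ⟨Complex.exp ((∑ i, z i).arg * Complex.I), Complex.norm_exp_ofReal_mul_I _, ?_⟩
    rw [mul_comm, Complex.norm_mul_exp_arg_mul_I]
  have hθ' : conj θ * θ = 1 := by rw [Complex.conj_mul', hθ]; simp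
  have hre : ∀ i, (conj θ * z i).re ≤ ‖z i‖ := fun i => by
    refine (Complex.re_le_norm _).trans ?_
    rw [norm_mul, RCLike.norm_conj, hθ, one_mul]
  have hsum : ∑ i, (conj θ * z i).re = ‖∑ i, z i‖ := by
    rw [← Complex.re_sum, ← Finset.mul_sum, hs, ← mul_assoc, hθ', one_mul, Complex.ofReal_re, ← hs]
  have heq := (Finset.sum_eq_sum_iff_of_le fun i (_ : i ∈ Finset.univ) => hre i).1
    (le_antisymm (Finset.sum_le_sum fun i _ => hre i) (hsum ▸ h))
  refine ⟨θ, hθ, fun i => ?_⟩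
  have h1 := heq i (Finset.mem_univ i)
  have h2 : conj θ * z i = ‖z i‖ := by
    have hn : ‖conj θ * z i‖ = ‖z i‖ := by rw [norm_mul, RCLike.norm_conj, hθ, one_mul]
    have := (Complex.re_eq_norm (z := conj θ * z i)).1 (by rw [h1, hn])
    apply Complex.ext
    · simpa using h1
    · simpa using (Complex.nonneg_iff.1 this).2.symm
  rw [← h2, ← mul_assoc, mul_comm θ, hθ', one_mul]

lemma rel_scale [Fintype ι] (hF : OverlapIncreasing F) (he : Orthonormal ℂ e)
    (h : ∀ i, PhaseRel F (e' i) (e i)) {a b : ι → ℂ}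
    (hab : PhaseRel F (∑ i, a i • e' i) (∑ i, b i • e i)) (t : ι → ℝ) (ht : ∀ i, 0 ≤ t i) :
    PhaseRel F (∑ i, ((t i : ℂ) * a i) • e' i) (∑ i, ((t i : ℂ) * b i) • e i) := by
  have he' := hF.orthonormal_of_rel he h
  have hba := hF.norm_coeff_eq he h hab
  obtain ⟨c, hc, hca⟩ := hF.rel_sum_coords he h (rel_map F (∑ i, ((t i : ℂ) * a i) • e' i))
  have hle2 := hF.rel_inner_le hab (rel_map F (∑ i, ((t i : ℂ) * a i) • e' i))
  rw [hc, he'.inner_sum, he.inner_sum] at hle2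
  have hcn : ∀ i, ‖c i‖ = t i * ‖b i‖ := fun i => by
    rw [hca, hba, norm_mul, Complex.norm_real, Real.norm_of_nonneg (ht i)]
  have hl : ∑ i, ‖conj (b i) * c i‖ = ‖∑ i, conj (a i) * ((t i : ℂ) * a i)‖ := by
    have : ∑ i, conj (a i) * ((t i : ℂ) * a i) = ((∑ i, t i * ‖a i‖ ^ 2 : ℝ) : ℂ) := by
      push_cast
      refine Finset.sum_congr rfl fun i _ => ?_
      rw [← Complex.conj_mul']
      ring
    rw [this, Complex.norm_real, Real.norm_of_nonneg
      (Finset.sum_nonneg fun i _ => mul_nonneg (ht i) (sq_nonneg _))]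
    refine Finset.sum_congr rfl fun i _ => ?_
    rw [norm_mul, RCLike.norm_conj, hcn, hba]
    ring
  obtain ⟨θ, hθ, hz⟩ := exists_common_phase _ (hl.trans_le hle2)
  have hcb : ∀ i, c i = θ * ((t i : ℂ) * b i) := fun i => by
    by_cases hb : b i = 0
    · have := hcn i
      rw [hb, norm_zero, mul_zero, norm_eq_zero] at this
      rw [this, hb]
      simp
    · have hb' : conj (b i) ≠ 0 := by simpa using hb
      apply mul_left_cancel₀ hb'
      rw [hz i, norm_mul, RCLike.norm_conj, hcn]
      push_cast
      linear_combination (-θ * t i) * Complex.conj_mul' (b i)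
  refine hF.rel_of_inner (rel_map F _) ?_ ?_
  · have : (‖∑ i, ((t i : ℂ) * b i) • e i‖) ^ 2 = ‖∑ i, ((t i : ℂ) * a i) • e' i‖ ^ 2 := by
      rw [he.norm_sum_smul_sq, he'.norm_sum_smul_sq]
      simp only [norm_mul, hba]
    exact (pow_left_inj₀ (norm_nonneg _) (norm_nonneg _) two_ne_zero).1 this
  · rw [hc]
    have : ∑ i, c i • e i = θ • ∑ i, ((t i : ℂ) * b i) • e i := by
      rw [Finset.smul_sum]
      exact Finset.sum_congr rfl fun i _ => by rw [hcb, smul_smul]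
    rw [this, inner_smul_left, norm_mul, RCLike.norm_conj, hθ, one_mul,
      inner_self_eq_norm_sq_to_K, he'.norm_sum_smul_sq, norm_pow, RCLike.norm_ofReal, abs_norm,
      he.norm_sum_smul_sq]
    simp only [norm_mul, hba, le_refl]

end Family

section Glue

variable {ι : Type*} {e' e : ι → H}

lemma rel_pair [Fintype ι] [DecidableEq ι] (hF : OverlapIncreasing F) (he : Orthonormal ℂ e)
    (h : ∀ i, PhaseRel F (e' i) (e i)) {a b : ι → ℂ}
    (hab : PhaseRel F (∑ i, a i • e' i) (∑ i, b i • e i)) {i j : ι} (hij : i ≠ j) :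
    PhaseRel F (a i • e' i + a j • e' j) (b i • e i + b j • e j) := by
  have key : ∀ (x : ι → ℂ) (u : ι → H),
      ∑ k, (((if k = i ∨ k = j then 1 else 0 : ℝ) : ℂ) * x k) • u k =
        x i • u i + x j • u j := fun x u => by
    rw [Finset.sum_eq_add i j hij]
    · simp
    · intro k _ hk
      simp [hk.1, hk.2]
    · simp
    · simp
  have := hF.rel_scale he h hab (fun k => if k = i ∨ k = j then 1 else 0)
    (fun k => by split_ifs <;> norm_num)
  rwa [key, key] at this

lemma rel_glue [Fintype ι] [DecidableEq ι] (hF : OverlapIncreasing F) (he : Orthonormal ℂ e)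
    (h : ∀ i, PhaseRel F (e' i) (e i)) {a b : ι → ℂ} (o : ι) (ha : a o ≠ 0)
    (hb : ‖b o‖ = ‖a o‖)
    (hp : ∀ i, i ≠ o → PhaseRel F (a o • e' o + a i • e' i) (b o • e o + b i • e i)) :
    PhaseRel F (∑ i, a i • e' i) (∑ i, b i • e i) := by
  obtain ⟨c, hc, hca⟩ := hF.rel_sum_coords he h (rel_map F (∑ i, a i • e' i))
  have hco : c o ≠ 0 := by
    rw [← norm_ne_zero_iff, hca]
    exact norm_ne_zero_iff.2 ha
  have hθ : ‖b o / c o‖ = 1 := by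
    rw [norm_div, hb, hca]
    exact div_self (norm_ne_zero_iff.2 ha)
  refine ⟨b o / c o, hθ, ?_⟩
  rw [hc, Finset.smul_sum]
  refine Finset.sum_congr rfl fun i _ => ?_
  rw [smul_smul]
  congr 1
  by_cases hio : i = o
  · subst hio
    field_simp
  have h1 := hF.rel_pair he h (hc ▸ rel_map F (∑ i, a i • e' i)) (Ne.symm hio)
  obtain ⟨d, -, hd⟩ := rel_unique h1 (hp i hio)
  have e1 := congrArg (fun x => ⟪e o, x⟫_ℂ) hd
  have e2 := congrArg (fun x => ⟪e i, x⟫_ℂ) hd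
  have n1 : ⟪e o, e o⟫_ℂ = 1 := by simp [inner_self_eq_norm_sq_to_K, he.1]
  have n2 : ⟪e i, e i⟫_ℂ = 1 := by simp [inner_self_eq_norm_sq_to_K, he.1]
  simp only [smul_add, inner_add_right, inner_smul_right, he.2 hio, he.2 (Ne.symm hio), n1, n2,
    mul_zero, add_zero, zero_add, mul_one] at e1 e2
  rw [e2, e1]
  field_simp

end Glue

section Pair

variable {e' f' g' e f g : H}

lemma _root_.orthonormal_pair (he : ‖e‖ = 1) (hf : ‖f‖ = 1) (hef : ⟪e, f⟫_ℂ = 0) :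
    Orthonormal ℂ ![e, f] := by
  have hfe := inner_eq_zero_symm.1 hef
  refine ⟨fun i => ?_, fun i j hij => ?_⟩
  · fin_cases i <;> simp [he, hf]
  · fin_cases i <;> fin_cases j <;> simp_all

lemma _root_.orthonormal_triple (he : ‖e‖ = 1) (hf : ‖f‖ = 1) (hg : ‖g‖ = 1) (hef : ⟪e, f⟫_ℂ = 0)
    (heg : ⟪e, g⟫_ℂ = 0) (hfg : ⟪f, g⟫_ℂ = 0) : Orthonormal ℂ ![e, f, g] := by
  have hfe := inner_eq_zero_symm.1 hef
  have hge := inner_eq_zero_symm.1 heg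
  have hgf := inner_eq_zero_symm.1 hfg
  refine ⟨fun i => ?_, fun i j hij => ?_⟩
  · fin_cases i <;> simp [he, hf, hg]
  · fin_cases i <;> fin_cases j <;> simp_all

lemma _root_.Orthonormal.inner_pair (h : Orthonormal ℂ ![e, f]) (a b c d : ℂ) :
    ⟪a • e + b • f, c • e + d • f⟫_ℂ = conj a * c + conj b * d := by
  have h1 := h.1 0
  have h2 := h.1 1
  have h3 := h.2 (show (0 : Fin 2) ≠ 1 by decide)
  have h4 := h.2 (show (1 : Fin 2) ≠ 0 by decide)
  simp only [Matrix.cons_val_zero, Matrix.cons_val_one] at h1 h2 h3 h4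
  simp only [inner_add_left, inner_add_right, inner_smul_left, inner_smul_right, h3, h4,
    inner_self_eq_norm_sq_to_K, h1, h2]
  simp
  ring

lemma _root_.Orthonormal.inner_pair_one (h : Orthonormal ℂ ![e, f]) (b d : ℂ) :
    ⟪e + b • f, e + d • f⟫_ℂ = 1 + conj b * d := by
  simpa using h.inner_pair 1 b 1 d

lemma rel_fin_two (he : PhaseRel F e' e) (hf : PhaseRel F f' f) :
    ∀ i, PhaseRel F (![e', f'] i) (![e, f] i) := by
  intro i
  fin_cases i <;> simp [he, hf]

lemma rel_fin_three (he : PhaseRel F e' e) (hf : PhaseRel F f' f) (hg : PhaseRel F g' g) :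
    ∀ i, PhaseRel F (![e', f', g'] i) (![e, f, g] i) := by
  intro i
  fin_cases i <;> simp [he, hf, hg]

/-- An orthonormal pair together with vectors representing preimages of it. -/
structure PairLift (F : H → H) (e' f' e f : H) : Prop where
  orthonormal : Orthonormal ℂ ![e, f]
  fst : PhaseRel F e' e
  snd : PhaseRel F f' f

namespace PairLift

lemma inner_eq_zero (h : PairLift F e' f' e f) : ⟪e, f⟫_ℂ = 0 :=
  h.orthonormal.2 (show (0 : Fin 2) ≠ 1 by decide)

lemma norm_fst (h : PairLift F e' f' e f) : ‖e‖ = 1 := h.orthonormal.1 0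

lemma norm_snd (h : PairLift F e' f' e f) : ‖f‖ = 1 := h.orthonormal.1 1

lemma symm (h : PairLift F e' f' e f) : PairLift F f' e' f e :=
  ⟨orthonormal_pair h.norm_snd h.norm_fst (inner_eq_zero_symm.1 h.inner_eq_zero), h.snd, h.fst⟩

lemma orthonormal' (h : PairLift F e' f' e f) (hF : OverlapIncreasing F) :
    Orthonormal ℂ ![e', f'] :=
  hF.orthonormal_of_rel h.orthonormal (rel_fin_two h.fst h.snd)

lemma coords (h : PairLift F e' f' e f) (hF : OverlapIncreasing F) {a b : ℂ} {v : H}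
    (hv : PhaseRel F (a • e' + b • f') v) :
    ∃ c d : ℂ, v = c • e + d • f ∧ ‖c‖ = ‖a‖ ∧ ‖d‖ = ‖b‖ := by
  obtain ⟨x, hx, hn⟩ := hF.rel_sum_coords h.orthonormal (rel_fin_two h.fst h.snd)
    (a := ![a, b]) (v := v) (by simpa using hv)
  exact ⟨x 0, x 1, by simpa using hx, by simpa using hn 0, by simpa using hn 1⟩

lemma exists_rel (h : PairLift F e' f' e f) (hF : OverlapIncreasing F) {s : ℂ} (hs : ‖s‖ = 1) :
    ∃ t : ℂ, ‖t‖ = 1 ∧ PhaseRel F (e' + s • f') (e + t • f) := by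
  obtain ⟨c, d, hv, hc, hd⟩ := h.coords hF (a := 1) (b := s) (rel_map F _)
  rw [one_smul] at hv
  rw [norm_one] at hc
  have hc0 : c ≠ 0 := by
    rintro rfl
    simp at hc
  refine ⟨c⁻¹ * d, by simp [hc, hd, hs], ⟨c⁻¹, by simp [hc], ?_⟩⟩
  rw [hv, smul_add, smul_smul, smul_smul, inv_mul_cancel₀ hc0, one_smul]

lemma unique (h : PairLift F e' f' e f) {v : H} {t t₂ : ℂ}
    (h₁ : PhaseRel F v (e + t • f)) (h₂ : PhaseRel F v (e + t₂ • f)) : t = t₂ := by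
  obtain ⟨c, -, hc⟩ := rel_unique h₁ h₂
  have e1 := congrArg (fun x => ⟪(1 : ℂ) • e + (0 : ℂ) • f, x⟫_ℂ) hc
  have e2 := congrArg (fun x => ⟪(0 : ℂ) • e + (1 : ℂ) • f, x⟫_ℂ) hc
  have h3 := h.orthonormal.inner_pair 1 0 1
  have h4 := h.orthonormal.inner_pair 0 1 1
  simp only [inner_smul_right, one_smul] at e1 e2 h3 h4
  rw [h3, h3] at e1
  rw [h4, h4] at e2
  simp only [map_one, map_zero, zero_mul, one_mul, add_zero, zero_add, mul_one] at e1 e2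
  rw [e2, ← e1, one_mul]

lemma norm_eq (h : PairLift F e' f' e f) (hF : OverlapIncreasing F) {s t : ℂ}
    (hst : PhaseRel F (e' + s • f') (e + t • f)) : ‖t‖ = ‖s‖ := by
  have := hF.norm_coeff_eq h.orthonormal (rel_fin_two h.fst h.snd) (a := ![1, s]) (b := ![1, t])
    (by simpa using hst) 1
  simpa using this

lemma inner_le (h : PairLift F e' f' e f) (hF : OverlapIncreasing F) {s t s₂ t₂ : ℂ}
    (h₁ : PhaseRel F (e' + s • f') (e + t • f)) (h₂ : PhaseRel F (e' + s₂ • f') (e + t₂ • f)) :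
    ‖1 + conj s * s₂‖ ≤ ‖1 + conj t * t₂‖ := by
  have := hF.rel_inner_le h₁ h₂
  rwa [h.orthonormal.inner_pair_one, (h.orthonormal' hF).inner_pair_one] at this

lemma inv_rel (h : PairLift F e' f' e f) (hF : OverlapIncreasing F) {s t : ℂ} (hs : ‖s‖ = 1)
    (hst : PhaseRel F (e' + s • f') (e + t • f)) : PhaseRel F (f' + s⁻¹ • e') (f + t⁻¹ • e) := by
  have ht := h.norm_eq hF hst
  have hs0 : s ≠ 0 := by
    rintro rfl
    simp at hs
  have ht0 : t ≠ 0 := by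
    rintro rfl
    simp [hs] at ht
  have := hF.rel_smul hst (c := s⁻¹) (d := t⁻¹) (by simp [ht])
  rw [smul_add, smul_add, smul_smul, smul_smul, inv_mul_cancel₀ hs0, inv_mul_cancel₀ ht0, one_smul,
    one_smul, add_comm, add_comm (t⁻¹ • e)] at this
  exact this

end PairLift

/-- An orthonormal triple together with vectors representing preimages of it. -/
structure TripleLift (F : H → H) (e' f' g' e f g : H) : Prop where
  orthonormal : Orthonormal ℂ ![e, f, g]
  fst : PhaseRel F e' e
  snd : PhaseRel F f' f
  thd : PhaseRel F g' g

namespace TripleLift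

lemma inner_eq_zero (h : TripleLift F e' f' g' e f g) :
    ⟪e, f⟫_ℂ = 0 ∧ ⟪e, g⟫_ℂ = 0 ∧ ⟪f, g⟫_ℂ = 0 :=
  ⟨h.orthonormal.2 (show (0 : Fin 3) ≠ 1 by decide),
    h.orthonormal.2 (show (0 : Fin 3) ≠ 2 by decide),
    h.orthonormal.2 (show (1 : Fin 3) ≠ 2 by decide)⟩

lemma norm_eq_one (h : TripleLift F e' f' g' e f g) : ‖e‖ = 1 ∧ ‖f‖ = 1 ∧ ‖g‖ = 1 :=
  ⟨h.orthonormal.1 0, h.orthonormal.1 1, h.orthonormal.1 2⟩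

lemma pair₁₂ (h : TripleLift F e' f' g' e f g) : PairLift F e' f' e f :=
  ⟨orthonormal_pair h.norm_eq_one.1 h.norm_eq_one.2.1 h.inner_eq_zero.1, h.fst, h.snd⟩

lemma pair₁₃ (h : TripleLift F e' f' g' e f g) : PairLift F e' g' e g :=
  ⟨orthonormal_pair h.norm_eq_one.1 h.norm_eq_one.2.2 h.inner_eq_zero.2.1, h.fst, h.thd⟩

lemma pair₂₃ (h : TripleLift F e' f' g' e f g) : PairLift F f' g' f g :=
  ⟨orthonormal_pair h.norm_eq_one.2.1 h.norm_eq_one.2.2 h.inner_eq_zero.2.2, h.snd, h.thd⟩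

lemma swap (h : TripleLift F e' f' g' e f g) : TripleLift F f' e' g' f e g :=
  ⟨orthonormal_triple h.norm_eq_one.2.1 h.norm_eq_one.1 h.norm_eq_one.2.2
    (inner_eq_zero_symm.1 h.inner_eq_zero.1) h.inner_eq_zero.2.2 h.inner_eq_zero.2.1,
    h.snd, h.fst, h.thd⟩

lemma glue (h : TripleLift F e' f' g' e f g) (hF : OverlapIncreasing F) {s t s₂ t₂ : ℂ}
    (h₁ : PhaseRel F (e' + s • f') (e + t • f)) (h₂ : PhaseRel F (e' + s₂ • g') (e + t₂ • g)) :
    PhaseRel F (e' + s • f' + s₂ • g') (e + t • f + t₂ • g) := by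
  have := hF.rel_glue h.orthonormal (rel_fin_three h.fst h.snd h.thd)
    (a := ![1, s, s₂]) (b := ![1, t, t₂]) 0 (by simp) (by simp) (fun i hi => by
      fin_cases i
      · simp at hi
      · simpa using h₁
      · simpa using h₂)
  simpa [Fin.sum_univ_three] using this

lemma rel_snd_thd (h : TripleLift F e' f' g' e f g) (hF : OverlapIncreasing F) {s t s₂ t₂ : ℂ}
    (h₁ : PhaseRel F (e' + s • f' + s₂ • g') (e + t • f + t₂ • g)) :
    PhaseRel F (s • f' + s₂ • g') (t • f + t₂ • g) := by
  have := hF.rel_pair h.orthonormal (rel_fin_three h.fst h.snd h.thd)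
    (a := ![1, s, s₂]) (b := ![1, t, t₂]) (by simpa [Fin.sum_univ_three] using h₁)
    (show (1 : Fin 3) ≠ 2 by decide)
  simpa using this

/-- Relative phases transform multiplicatively along an orthonormal triple. -/
lemma cocycle (h : TripleLift F e' f' g' e f g) (hF : OverlapIncreasing F) {s t s₂ t₂ : ℂ}
    (hs : ‖s‖ = 1) (h₁ : PhaseRel F (e' + s • f') (e + t • f))
    (h₂ : PhaseRel F (f' + s₂ • g') (f + t₂ • g)) :
    PhaseRel F (e' + (s * s₂) • g') (e + (t * t₂) • g) := by
  have ht := h.pair₁₂.norm_eq hF h₁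
  have hs0 : s ≠ 0 := by
    rintro rfl
    simp at hs
  have ht0 : t ≠ 0 := by
    rintro rfl
    simp [hs] at ht
  have h3 := h.swap.rel_snd_thd hF (h.swap.glue hF (h.pair₁₂.inv_rel hF hs h₁) h₂)
  have := hF.rel_smul h3 (c := s) (d := t) ht
  rwa [smul_add, smul_add, smul_smul, smul_smul, smul_smul, smul_smul, mul_inv_cancel₀ hs0,
    mul_inv_cancel₀ ht0, one_smul, one_smul] at this

end TripleLift

end Pair

section Triple

variable {e' f' g' e f g : H}

lemma _root_.Complex.false_of_one_le_norm_add {c d ω : ℂ} (hc : ‖c‖ = 1) (hd : ‖d‖ = 1 / 2)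
    (hω : ω = ⟨-1 / 2, √3 / 2⟩) (h₁ : 1 ≤ ‖c + d‖) (h₂ : 1 ≤ ‖c + d * ω‖)
    (h₃ : 1 ≤ ‖c + d * conj ω‖) : False := by
  have h3 : √3 ^ 2 = 3 := Real.sq_sqrt (by norm_num)
  have hc2 : ‖c‖ ^ 2 = 1 := by rw [hc, one_pow]
  have hd2 : ‖d‖ ^ 2 = 1 / 4 := by rw [hd]; norm_num
  have k₁ : 1 ≤ ‖c + d‖ ^ 2 := one_le_pow₀ h₁
  have k₂ : 1 ≤ ‖c + d * ω‖ ^ 2 := one_le_pow₀ h₂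
  have k₃ : 1 ≤ ‖c + d * conj ω‖ ^ 2 := one_le_pow₀ h₃
  obtain ⟨c₁, c₂⟩ := c
  obtain ⟨d₁, d₂⟩ := d
  subst hω
  simp only [Complex.sq_norm, Complex.normSq_apply, Complex.add_re, Complex.add_im, Complex.mul_re,
    Complex.mul_im, Complex.conj_re, Complex.conj_im] at hc2 hd2 k₁ k₂ k₃
  generalize √3 = r at *
  obtain ⟨x, hx⟩ : ∃ x, x = c₁ * d₁ + c₂ * d₂ := ⟨_, rfl⟩
  obtain ⟨y, hy⟩ : ∃ y, y = c₁ * d₂ - c₂ * d₁ := ⟨_, rfl⟩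
  have hxy : x ^ 2 + y ^ 2 = 1 / 4 := by
    rw [hx, hy]
    linear_combination (d₁ ^ 2 + d₂ ^ 2) * hc2 + hd2
  have l₁ : -1 / 8 ≤ x := by nlinarith
  have l₂ : -1 / 8 ≤ -x / 2 - y * r / 2 := by
    have : (c₁ + (d₁ * (-1 / 2) - d₂ * (r / 2))) * (c₁ + (d₁ * (-1 / 2) - d₂ * (r / 2))) +
        (c₂ + (d₁ * (r / 2) + d₂ * (-1 / 2))) * (c₂ + (d₁ * (r / 2) + d₂ * (-1 / 2))) =
        5 / 4 + 2 * (-x / 2 - y * r / 2) := by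
      rw [hx, hy]
      linear_combination hc2 + hd2 + (d₁ ^ 2 + d₂ ^ 2) / 4 * h3
    linarith
  have l₃ : -1 / 8 ≤ -x / 2 + y * r / 2 := by
    have : (c₁ + (d₁ * (-1 / 2) - d₂ * -(r / 2))) * (c₁ + (d₁ * (-1 / 2) - d₂ * -(r / 2))) +
        (c₂ + (d₁ * -(r / 2) + d₂ * (-1 / 2))) * (c₂ + (d₁ * -(r / 2) + d₂ * (-1 / 2))) =
        5 / 4 + 2 * (-x / 2 + y * r / 2) := by
      rw [hx, hy]
      linear_combination hc2 + hd2 + (d₁ ^ 2 + d₂ ^ 2) / 4 * h3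
    linarith
  have l₄ : 0 ≤ (1 / 4 - x) ^ 2 - 3 * y ^ 2 := by
    have := mul_nonneg (by linarith : 0 ≤ 1 / 4 - x - y * r) (by linarith : 0 ≤ 1 / 4 - x + y * r)
    nlinarith
  nlinarith

lemma _root_.Orthonormal.inner_triple (h : Orthonormal ℂ ![e, f, g]) (a b c a₂ b₂ c₂ : ℂ) :
    ⟪a • e + b • f + c • g, a₂ • e + b₂ • f + c₂ • g⟫_ℂ =
      conj a * a₂ + conj b * b₂ + conj c * c₂ := by
  have := h.inner_sum ![a, b, c] ![a₂, b₂, c₂] Finset.univ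
  simp only [Fin.sum_univ_three, Matrix.cons_val] at this
  exact this

/-- The four sign combinations of an orthonormal triple cannot be identified. -/
lemma TripleLift.not_forall_sign (h : TripleLift F e' f' g' e f g) (hF : OverlapIncreasing F)
    (h₁ : PhaseRel F (e' + f' + g') (e + f + g)) (h₂ : PhaseRel F (e' - f' + g') (e + f + g))
    (h₃ : PhaseRel F (e' + f' - g') (e + f + g)) : False := by
  obtain ⟨ω, hω⟩ : ∃ ω : ℂ, ω = ⟨-1 / 2, √3 / 2⟩ := ⟨_, rfl⟩
  have hr3 : √3 * √3 = 3 := Real.mul_self_sqrt (by norm_num)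
  have hωsum : 1 + ω + conj ω = 0 := by
    apply Complex.ext <;> simp [hω]
    norm_num
  have hωω : conj ω * ω = 1 := by
    apply Complex.ext <;> simp [hω]
    · linarith
    · ring
  have he' := hF.orthonormal_of_rel h.orthonormal (rel_fin_three h.fst h.snd h.thd)
  obtain ⟨q', hq⟩ := hF.rel_surj (e + ω • f + conj ω • g)
  have hpq : ⟪e + f + g, e + ω • f + conj ω • g⟫_ℂ = 0 := by
    have := h.orthonormal.inner_triple 1 1 1 1 ω (conj ω)
    simp only [one_smul, map_one, one_mul] at this
    rw [this, hωsum]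
  have o₁ := hF.orthogonal_of_rel h₁ hq hpq
  have o₂ := hF.orthogonal_of_rel h₂ hq hpq
  have o₃ := hF.orthogonal_of_rel h₃ hq hpq
  simp only [inner_add_left, inner_sub_left] at o₁ o₂ o₃
  have oe : ⟪e', q'⟫_ℂ = 0 := by linear_combination (o₂ + o₃) / 2
  have of : ⟪f', q'⟫_ℂ = 0 := by linear_combination (o₁ - o₂) / 2
  have og : ⟪g', q'⟫_ℂ = 0 := by linear_combination (o₁ - o₃) / 2
  obtain ⟨r, hr⟩ : ∃ r : ℂ, r = ((√3)⁻¹ : ℝ) := ⟨_, rfl⟩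
  have hrpos : 0 < ‖r‖ := by
    rw [hr, Complex.norm_real, norm_pos_iff]
    positivity
  have hrr : conj r * r * 3 = 1 := by
    rw [hr, Complex.conj_ofReal, ← Complex.ofReal_mul, ← mul_inv, hr3]
    norm_num
  have hone : ∀ v : H, ⟪v, v⟫_ℂ = 1 → ‖v‖ = 1 := fun v hv => by
    rw [norm_eq_sqrt_re_inner (𝕜 := ℂ), hv]
    simp
  have hP : PairLift F (r • (e' + f' + g')) (r • q') (r • (e + f + g))
      (r • (e + ω • f + conj ω • g)) := by
    refine ⟨orthonormal_pair (hone _ ?_) (hone _ ?_) ?_, hF.rel_smul h₁ rfl, hF.rel_smul hq rfl⟩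
    · have := h.orthonormal.inner_triple 1 1 1 1 1 1
      simp only [one_smul] at this
      rw [inner_smul_left, inner_smul_right, this]
      simp only [map_one]
      linear_combination hrr
    · have := h.orthonormal.inner_triple 1 ω (conj ω) 1 ω (conj ω)
      simp only [one_smul] at this
      rw [inner_smul_left, inner_smul_right, this]
      simp only [map_one, Complex.conj_conj]
      linear_combination hrr + 2 * conj r * r * hωω
    · rw [inner_smul_left, inner_smul_right, hpq]
      simp
  obtain ⟨c, d, hv, hc, hd⟩ := hP.coords hF (a := 1) (b := 1 / 2) (rel_map F _)
  have hv' := rel_map F ((1 : ℂ) • r • (e' + f' + g') + (1 / 2 : ℂ) • r • q')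
  rw [hv] at hv'
  have i₁ := hF.rel_inner_le h.fst hv'
  have i₂ := hF.rel_inner_le h.snd hv'
  have i₃ := hF.rel_inner_le h.thd hv'
  have l : ∀ z : ℂ, ‖r‖ ≤ ‖r * z‖ → 1 ≤ ‖z‖ := fun z hz => by
    rw [norm_mul] at hz
    exact le_of_mul_le_mul_left (by rwa [mul_one]) hrpos
  have n := he'.1
  have m := h.orthonormal.1
  have a1 : ⟪e', f'⟫_ℂ = 0 := he'.2 (show (0 : Fin 3) ≠ 1 by decide)
  have a2 : ⟪e', g'⟫_ℂ = 0 := he'.2 (show (0 : Fin 3) ≠ 2 by decide)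
  have a3 : ⟪f', g'⟫_ℂ = 0 := he'.2 (show (1 : Fin 3) ≠ 2 by decide)
  obtain ⟨b1, b2, b3⟩ := h.inner_eq_zero
  have n0 : ‖e'‖ = 1 := n 0
  have n1 : ‖f'‖ = 1 := n 1
  have n2 : ‖g'‖ = 1 := n 2
  obtain ⟨m0, m1, m2⟩ := h.norm_eq_one
  simp only [inner_add_right, inner_smul_right, inner_self_eq_norm_sq_to_K, a1, a2, a3, b1, b2, b3,
    inner_eq_zero_symm.1 a1, inner_eq_zero_symm.1 a2, inner_eq_zero_symm.1 a3,
    inner_eq_zero_symm.1 b1, inner_eq_zero_symm.1 b2, inner_eq_zero_symm.1 b3, n0, n1, n2, m0, m1,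
    m2, oe, of, og, RCLike.ofReal_one, one_pow, mul_zero, add_zero, zero_add, mul_one, one_mul]
    at i₁ i₂ i₃
  refine Complex.false_of_one_le_norm_add (c := c) (d := d) (by simpa using hc)
    (by simpa using hd) hω (l _ (i₁.trans_eq ?_)) (l _ (i₂.trans_eq ?_)) (l _ (i₃.trans_eq ?_))
  · congr 1
    ring
  · congr 1
    ring
  · congr 1
    ring

lemma TripleLift.rel_sub (h : TripleLift F e' f' g' e f g) (hF : OverlapIncreasing F)
    (h₁ : PhaseRel F (e' + f') (e + f)) (h₂ : PhaseRel F (f' + g') (f + g)) :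
    PhaseRel F (e' - f') (e - f) := by
  have h₁' : PhaseRel F (e' + (1 : ℂ) • f') (e + (1 : ℂ) • f) := by simpa using h₁
  have h₂' : PhaseRel F (f' + (1 : ℂ) • g') (f + (1 : ℂ) • g) := by simpa using h₂
  obtain ⟨x, hx, hx'⟩ := h.pair₁₂.exists_rel hF (s := -1) (by simp)
  obtain ⟨y, hy, hy'⟩ := h.pair₂₃.exists_rel hF (s := -1) (by simp)
  have c₁ := h.cocycle hF (by simp) h₁' h₂'
  have c₂ := h.cocycle hF (by simp) hx' h₂'
  have c₃ := h.cocycle hF (by simp) h₁' hy'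
  have c₄ := h.cocycle hF (by simp) hx' hy'
  simp only [mul_one, one_mul, neg_mul_neg] at c₁ c₂ c₃ c₄
  have hyx : y = x := h.pair₁₃.unique c₃ c₂
  subst hyx
  have hyy : y * y = 1 := h.pair₁₃.unique c₄ c₁
  rcases mul_self_eq_one_iff.1 hyy with rfl | rfl
  · exfalso
    refine h.not_forall_sign hF ?_ ?_ ?_
    · simpa using h.glue hF h₁' c₁
    · simpa [sub_eq_add_neg] using h.glue hF hx' c₁
    · simpa [sub_eq_add_neg] using h.glue hF h₁' c₂
  · simpa [sub_eq_add_neg] using hx'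

end Triple

section Quad

variable {e' f' g' e f g : H}

lemma _root_.Complex.eq_I_or_eq_neg_I {z : ℂ} (hz : ‖z‖ = 1) (hre : z.re = 0) :
    z = Complex.I ∨ z = -Complex.I := by
  have h : ‖z‖ ^ 2 = 1 := by rw [hz, one_pow]
  rw [Complex.sq_norm, Complex.normSq_apply, hre, mul_zero, zero_add] at h
  rcases mul_self_eq_one_iff.1 h with h | h
  · exact Or.inl (Complex.ext (by simp [hre]) (by simp [h]))
  · exact Or.inr (Complex.ext (by simp [hre]) (by simp [h]))

lemma _root_.Complex.norm_one_add_le_iff {z w : ℂ} (h : ‖z‖ = ‖w‖) :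
    ‖1 + z‖ ≤ ‖1 + w‖ ↔ z.re ≤ w.re := by
  have h2 : ‖z‖ ^ 2 = ‖w‖ ^ 2 := by rw [h]
  rw [← pow_le_pow_iff_left₀ (norm_nonneg _) (norm_nonneg _) two_ne_zero]
  simp only [Complex.sq_norm, Complex.normSq_apply, Complex.add_re, Complex.add_im, Complex.one_re,
    Complex.one_im] at h2 ⊢
  constructor <;> intro h <;> linarith

/-- Without a third orthogonal direction, every vector with coordinates of modulus one in the
target pair is related to such a vector in the source pair. -/
lemma PairLift.exists_rel_of_span (h : PairLift F e' f' e f) (hF : OverlapIncreasing F)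
    (hg : ¬ ∃ g : H, ‖g‖ = 1 ∧ ⟪e, g⟫_ℂ = 0 ∧ ⟪f, g⟫_ℂ = 0) {s : ℂ} (hs : ‖s‖ = 1) :
    ∃ t : ℂ, ‖t‖ = 1 ∧ PhaseRel F (e' + t • f') (e + s • f) := by
  have hee : ⟪e, e⟫_ℂ = 1 := by simp [inner_self_eq_norm_sq_to_K, h.norm_fst]
  have hff : ⟪f, f⟫_ℂ = 1 := by simp [inner_self_eq_norm_sq_to_K, h.norm_snd]
  have hspan : ∀ x : H, x = ⟪e, x⟫_ℂ • e + ⟪f, x⟫_ℂ • f := fun x => by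
    by_contra hx
    have hx0 : x - (⟪e, x⟫_ℂ • e + ⟪f, x⟫_ℂ • f) ≠ 0 := sub_ne_zero.2 hx
    refine hg ⟨((‖x - (⟪e, x⟫_ℂ • e + ⟪f, x⟫_ℂ • f)‖⁻¹ : ℝ) : ℂ) •
      (x - (⟪e, x⟫_ℂ • e + ⟪f, x⟫_ℂ • f)), ?_, ?_, ?_⟩
    · rw [norm_smul, Complex.norm_real, norm_inv, norm_norm,
        inv_mul_cancel₀ (norm_ne_zero_iff.2 hx0)]
    · simp only [inner_smul_right, inner_sub_right, inner_add_right, hee, h.inner_eq_zero]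
      ring
    · simp only [inner_smul_right, inner_sub_right, inner_add_right, hff, h.symm.inner_eq_zero]
      ring
  have hrange : ∀ u v : H, Set.range ![u, v] = {u, v} := fun u v => by
    simp [Matrix.range_cons, Set.pair_comm]
  have htop : Submodule.span ℂ (Set.range ![e, f]) = ⊤ := by
    rw [eq_top_iff, hrange]
    intro x _
    exact Submodule.mem_span_pair.2 ⟨_, _, (hspan x).symm⟩
  have hdim : Module.finrank ℂ H = 2 := by
    have := finrank_span_eq_card h.orthonormal.linearIndependent
    rw [htop, finrank_top] at this
    simpa using this
  have htop' : Submodule.span ℂ (Set.range ![e', f']) = ⊤ :=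
    (h.orthonormal' hF).linearIndependent.span_eq_top_of_card_eq_finrank (by simp [hdim])
  obtain ⟨v, hv⟩ := hF.rel_surj (e + s • f)
  have hvmem : v ∈ Submodule.span ℂ ({e', f'} : Set H) := by
    rw [← hrange, htop']
    trivial
  obtain ⟨a, b, rfl⟩ := Submodule.mem_span_pair.1 hvmem
  have hab := hF.norm_coeff_eq h.orthonormal (rel_fin_two h.fst h.snd) (a := ![a, b])
    (b := ![1, s]) (by simpa using hv)
  have ha : ‖a‖ = 1 := by simpa using (hab 0).symm
  have hb : ‖b‖ = 1 := by simpa [hs] using (hab 1).symm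
  have ha0 : a ≠ 0 := by
    rintro rfl
    simp at ha
  refine ⟨a⁻¹ * b, by simp [ha, hb], ?_⟩
  have := hF.rel_smul hv (c := a⁻¹) (d := 1) (by simp [ha])
  rwa [one_smul, smul_add, smul_smul, smul_smul, inv_mul_cancel₀ ha0, one_smul] at this

lemma PairLift.eq_neg_of_rel (h : PairLift F e' f' e f) (hF : OverlapIncreasing F) {s t s₂ : ℂ}
    (hs : ‖s‖ = 1) (ht : ‖t‖ = 1) (h₁ : PhaseRel F (e' + s • f') (e + t • f))
    (h₂ : PhaseRel F (e' + s₂ • f') (e + (-t) • f)) : s₂ = -s := by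
  have := h.inner_le hF h₁ h₂
  rw [mul_neg, Complex.conj_mul', ht] at this
  simp only [Complex.ofReal_one, one_pow, add_neg_cancel, norm_zero] at this
  have h0 : 1 + conj s * s₂ = 0 := norm_le_zero_iff.1 this
  have hss : conj s * s = 1 := by rw [Complex.conj_mul', hs]; simp
  linear_combination s * h0 - s₂ * hss

lemma PairLift.exists_sign (h : PairLift F e' f' e f) (hF : OverlapIncreasing F)
    (h₁ : PhaseRel F (e' + f') (e + f)) :
    ∃ z : ℂ, (z = Complex.I ∨ z = -Complex.I) ∧ PhaseRel F (e' - f') (e - f) ∧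
      PhaseRel F (e' + Complex.I • f') (e + z • f) ∧
      PhaseRel F (e' - Complex.I • f') (e - z • f) := by
  have h₁' : PhaseRel F (e' + (1 : ℂ) • f') (e + (1 : ℂ) • f) := by simpa using h₁
  by_cases hg : ∃ g : H, ‖g‖ = 1 ∧ ⟪e, g⟫_ℂ = 0 ∧ ⟪f, g⟫_ℂ = 0
  · obtain ⟨g, hg1, heg, hfg⟩ := hg
    obtain ⟨g', hg'⟩ := hF.rel_surj g
    obtain ⟨t, ht, ht'⟩ := PairLift.exists_rel
      (⟨orthonormal_pair h.norm_snd hg1 hfg, h.snd, hg'⟩ : PairLift F f' g' f g) hF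
      (s := 1) (by simp)
    have hT : TripleLift F e' f' g' e f (t • g) := by
      refine ⟨orthonormal_triple h.norm_fst h.norm_snd (by rw [norm_smul, ht, hg1, one_mul])
        h.inner_eq_zero (by rw [inner_smul_right, heg, mul_zero])
        (by rw [inner_smul_right, hfg, mul_zero]), h.fst, h.snd, ?_⟩
      simpa using hF.rel_smul hg' (c := 1) (d := t) (by simp [ht])
    have h₂' : PhaseRel F (f' + (1 : ℂ) • g') (f + (1 : ℂ) • t • g) := by simpa using ht'
    have hm := hT.rel_sub hF h₁ (by simpa using h₂')
    have hm' : PhaseRel F (e' + (-1 : ℂ) • f') (e + (-1 : ℂ) • f) := by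
      simpa [sub_eq_add_neg] using hm
    have c₁ := hT.cocycle hF (by simp) h₁' h₂'
    have c₂ := hT.cocycle hF (by simp) hm' h₂'
    obtain ⟨y, hy, hy'⟩ := hT.pair₂₃.exists_rel hF (s := -1) (by simp)
    have c₃ := hT.cocycle hF (by simp) h₁' hy'
    simp only [one_mul, mul_one] at c₂ c₃
    obtain rfl := hT.pair₁₃.unique c₂ c₃
    obtain ⟨z, hz, hz'⟩ := h.exists_rel hF (s := Complex.I) (by simp)
    obtain ⟨w, hw, hw'⟩ := h.exists_rel hF (s := -Complex.I) (by simp)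
    have c₄ := hT.cocycle hF (by simp) hz' hy'
    have c₅ := hT.cocycle hF (by simp) hw' h₂'
    simp only [mul_neg, mul_one] at c₄ c₅
    obtain rfl := hT.pair₁₃.unique c₄ c₅
    have i₁ := h.inner_le hF h₁' hz'
    have i₂ := h.inner_le hF hm' hz'
    rw [Complex.norm_one_add_le_iff (by simp [hz])] at i₁ i₂
    simp at i₁ i₂
    exact ⟨z, Complex.eq_I_or_eq_neg_I hz (le_antisymm i₂ i₁), hm, hz',
      by simpa [sub_eq_add_neg] using hw'⟩
  · obtain ⟨y, hy, hy'⟩ := h.exists_rel_of_span hF hg (s := -1) (by simp)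
    obtain rfl := h.eq_neg_of_rel hF (by simp) (by simp) h₁' hy'
    obtain ⟨z, hz, hz'⟩ := h.exists_rel_of_span hF hg (s := Complex.I) (by simp)
    obtain ⟨w, hw, hw'⟩ := h.exists_rel_of_span hF hg (s := -Complex.I) (by simp)
    obtain rfl := h.eq_neg_of_rel hF hz (by simp) hz' hw'
    have i₁ := h.inner_le hF h₁' hz'
    have i₂ := h.inner_le hF hy' hz'
    rw [Complex.norm_one_add_le_iff (by simp [hz])] at i₁ i₂
    simp at i₁ i₂
    have hm : PhaseRel F (e' - f') (e - f) := by simpa [sub_eq_add_neg] using hy'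
    rcases Complex.eq_I_or_eq_neg_I hz (le_antisymm i₁ i₂) with rfl | rfl
    · exact ⟨Complex.I, Or.inl rfl, hm, hz', by simpa [sub_eq_add_neg] using hw'⟩
    · exact ⟨-Complex.I, Or.inr rfl, hm, by simpa using hw', by simpa [sub_eq_add_neg] using hz'⟩

lemma PairLift.rel_of_rel_four (h : PairLift F e' f' e f) (hF : OverlapIncreasing F)
    (h₁ : PhaseRel F (e' + f') (e + f)) (h₂ : PhaseRel F (e' - f') (e - f))
    (h₃ : PhaseRel F (e' + Complex.I • f') (e + Complex.I • f))
    (h₄ : PhaseRel F (e' - Complex.I • f') (e - Complex.I • f)) (a b : ℂ) :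
    PhaseRel F (a • e' + b • f') (a • e + b • f) := by
  obtain ⟨c, d, hv, hc, hd⟩ := h.coords hF (rel_map F (a • e' + b • f'))
  have hR := rel_map F (a • e' + b • f')
  rw [hv] at hR
  have key : ∀ t : ℂ, PhaseRel F (e' + t • f') (e + t • f) →
      ‖a + conj t * b‖ ^ 2 ≤ ‖c + conj t * d‖ ^ 2 := fun t ht => by
    have := hF.rel_inner_le ht hR
    have i₁ := (h.orthonormal' hF).inner_pair 1 t a b
    have i₂ := h.orthonormal.inner_pair 1 t c d
    simp only [one_smul, map_one, one_mul] at i₁ i₂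
    rw [i₁, i₂] at this
    exact pow_le_pow_left₀ (norm_nonneg _) this 2
  have k₁ := key 1 (by simpa using h₁)
  have k₂ := key (-1) (by simpa [sub_eq_add_neg] using h₂)
  have k₃ := key Complex.I h₃
  have k₄ := key (-Complex.I) (by simpa [sub_eq_add_neg] using h₄)
  have hc2 : ‖c‖ ^ 2 = ‖a‖ ^ 2 := by rw [hc]
  have hd2 : ‖d‖ ^ 2 = ‖b‖ ^ 2 := by rw [hd]
  have hcd : conj c * d = conj a * b := by
    simp only [Complex.sq_norm, Complex.normSq_apply, Complex.add_re, Complex.add_im,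
      Complex.mul_re, Complex.mul_im, Complex.conj_re, Complex.conj_im, Complex.I_re, Complex.I_im,
      map_one, map_neg, Complex.neg_re, Complex.neg_im, Complex.one_re, Complex.one_im]
      at k₁ k₂ k₃ k₄ hc2 hd2
    apply Complex.ext <;> simp only [Complex.mul_re, Complex.mul_im, Complex.conj_re,
      Complex.conj_im] <;> linarith
  refine hF.rel_of_inner hR ?_ ?_
  · rw [← pow_left_inj₀ (norm_nonneg _) (norm_nonneg _) two_ne_zero]
    have n₁ := h.orthonormal.norm_sum_smul_sq ![a, b]
    have n₂ := (h.orthonormal' hF).norm_sum_smul_sq ![a, b]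
    simp only [Fin.sum_univ_two, Matrix.cons_val] at n₁ n₂
    rw [n₁, n₂]
  · rw [h.orthonormal.inner_pair]
    have n₂ := (h.orthonormal' hF).norm_sum_smul_sq ![a, b]
    simp only [Fin.sum_univ_two, Matrix.cons_val] at n₂
    rw [n₂]
    refine (pow_le_pow_iff_left₀ (by positivity) (norm_nonneg _) two_ne_zero).1 (le_of_eq ?_)
    have hdc : conj d * c = conj b * a := by simpa [mul_comm] using congrArg conj hcd
    have e1 := Complex.conj_mul' c
    have e2 := Complex.conj_mul' d
    have e3 := Complex.conj_mul' a
    have e4 := Complex.conj_mul' b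
    rw [hc] at e1
    rw [hd] at e2
    have : (((‖a‖ ^ 2 + ‖b‖ ^ 2) ^ 2 : ℝ) : ℂ) = ((‖conj c * a + conj d * b‖ ^ 2 : ℝ) : ℂ) := by
      push_cast
      rw [← Complex.conj_mul' (_ + _), ← e3, ← e4]
      simp only [map_add, map_mul, Complex.conj_conj]
      rw [← e3] at e1
      rw [← e4] at e2
      linear_combination (-conj a * a) * e1 - (conj b * b) * e2 - (conj a * b) * hdc -
        (conj b * a) * hcd
    exact_mod_cast this

/-- The sign is the same for two pairs sharing their first vector. -/
lemma TripleLift.sign_eq (h : TripleLift F e' f' g' e f g) (hF : OverlapIncreasing F)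
    (h₁ : PhaseRel F (e' + f') (e + f)) (h₂ : PhaseRel F (e' + g') (e + g)) {z z₂ : ℂ}
    (hz : PhaseRel F (e' + Complex.I • f') (e + z • f))
    (hz₂ : PhaseRel F (e' + Complex.I • g') (e + z₂ • g)) : z = z₂ := by
  have h₃ := h.rel_snd_thd hF (s := 1) (t := 1) (s₂ := 1) (t₂ := 1)
    (h.glue hF (by simpa using h₁) (by simpa using h₂))
  have := h.cocycle hF (by simp) hz (s₂ := 1) (t₂ := 1) (by simpa using h₃)
  rw [mul_one, mul_one] at this
  exact h.pair₁₃.unique this hz₂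

end Quad

section Basis

variable {ι : Type*} {e' : ι → H} {b : HilbertBasis ι ℂ H} {o : ι}

lemma rel_finset_sum (hF : OverlapIncreasing F) (h : ∀ i, PhaseRel F (e' i) (b i))
    (hp : ∀ i, i ≠ o → ∀ x y : ℂ, PhaseRel F (x • e' o + y • e' i) (x • b o + y • b i))
    (s : Finset ι) (ho : o ∈ s) (a : ι → ℂ) :
    PhaseRel F (∑ i ∈ s, a i • e' i) (∑ i ∈ s, a i • b i) := by
  classical
  have hon : Orthonormal ℂ (fun i : s => b i) :=
    b.orthonormal.comp _ Subtype.val_injective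
  have key : ∀ a : ι → ℂ, a o ≠ 0 →
      PhaseRel F (∑ i : s, a i • e' i) (∑ i : s, a i • b i) := fun a ha =>
    hF.rel_glue (e' := fun i : s => e' i) (e := fun i : s => b i) hon (fun i => h i)
      (a := fun i => a i) (b := fun i => a i) ⟨o, ho⟩ ha rfl
      fun i hi => hp i (fun h => hi (Subtype.ext h)) _ _
  rw [← Finset.sum_coe_sort s fun i => a i • e' i, ← Finset.sum_coe_sort s fun i => a i • b i]
  by_cases ha : a o = 0
  · have := hF.rel_scale (e' := fun i : s => e' i) hon (fun i => h i)
      (key (Function.update a o 1) (by simp)) (fun i => if i.1 = o then 0 else 1)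
      (fun i => by split_ifs <;> norm_num)
    have hc : ∀ i : s, (((if i.1 = o then 0 else 1 : ℝ) : ℂ) * Function.update a o 1 i) = a i := by
      intro i
      by_cases hi : i.1 = o
      · simp [hi, ha]
      · simp [hi]
    simpa only [hc] using this
  · exact key a ha

/-- If all relations between a basis vector and the others are linear, then `F` has a linear
isometric section up to phases. -/
lemma exists_linearIsometry (hF : OverlapIncreasing F) (h : ∀ i, PhaseRel F (e' i) (b i))
    (hp : ∀ i, i ≠ o → ∀ x y : ℂ, PhaseRel F (x • e' o + y • e' i) (x • b o + y • b i)) :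
    ∃ W : H →ₗᵢ[ℂ] H, ∀ x, PhaseRel F (W x) x := by
  classical
  have he' : Orthonormal ℂ e' := hF.orthonormal_of_rel b.orthonormal h
  obtain ⟨W, hW⟩ : ∃ W : H →ₗᵢ[ℂ] H, ∀ i, W (b i) = e' i := by
    refine ⟨he'.orthogonalFamily.linearIsometry.comp b.repr.toLinearIsometry, fun i => ?_⟩
    exact (congrArg he'.orthogonalFamily.linearIsometry (b.repr_self i)).trans
      ((OrthogonalFamily.linearIsometry_apply_single _ _).trans (one_smul ℂ (e' i)))
  refine ⟨W, fun x => hF.rel_of_inner (rel_map F _) (W.norm_map x).symm ?_⟩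
  have hx : Filter.Tendsto (fun s : Finset ι => ∑ i ∈ s, b.repr x i • b i) Filter.atTop (nhds x) :=
    b.hasSum_repr x
  have t₁ := (Filter.Tendsto.inner (𝕜 := ℂ) (tendsto_const_nhds (x := x)) hx).norm
  have t₂ := (Filter.Tendsto.inner (𝕜 := ℂ) (tendsto_const_nhds (x := F (W x))) hx).norm
  have hle := le_of_tendsto_of_tendsto t₁ t₂ (by
    filter_upwards [Filter.eventually_ge_atTop {o}] with s hs
    have hs := hF.rel_finset_sum h hp s (Finset.singleton_subset_iff.1 hs) (fun i => b.repr x i)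
    have hWs : W (∑ i ∈ s, b.repr x i • b i) = ∑ i ∈ s, b.repr x i • e' i := by
      simp [map_sum, hW]
    rw [← hWs] at hs
    have := hF.rel_inner_le (rel_map F (W x)) hs
    rwa [W.inner_map_map] at this)
  rw [inner_self_eq_norm_sq_to_K, norm_pow, RCLike.norm_ofReal, abs_norm] at hle
  rwa [W.norm_map]

lemma surjective_of_rel (hF : OverlapIncreasing F) (hdim : 2 ≤ Module.rank ℂ H) (W : H →ₗᵢ[ℂ] H)
    (hW : ∀ x, PhaseRel F (W x) x) : Function.Surjective W := by
  rw [← LinearIsometry.coe_toLinearMap, ← LinearMap.range_eq_top]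
  have hcl : IsClosed (LinearMap.range W.toLinearMap : Set H) := by
    rw [LinearMap.coe_range]
    exact W.isometry.isClosedEmbedding.isClosed_range
  have := hcl.completeSpace_coe
  rw [← Submodule.orthogonal_eq_bot_iff, Submodule.eq_bot_iff]
  intro w hw
  by_contra hw0
  have hw' : ∀ x, ⟪W x, w⟫_ℂ = 0 := fun x => (Submodule.mem_orthogonal _ _).1 hw _ ⟨x, rfl⟩
  obtain ⟨x, hx0, hx⟩ : ∃ x : H, x ≠ 0 ∧ ⟪F w, x⟫_ℂ = 0 := by
    by_contra! hcon
    have hle : Module.rank ℂ H ≤ 1 := by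
      rw [rank_le_one_iff]
      refine ⟨F w, fun v => ⟨⟪F w, v⟫_ℂ / ⟪F w, F w⟫_ℂ, ?_⟩⟩
      have hz : ⟪F w, F w⟫_ℂ ≠ 0 := by
        rw [inner_self_ne_zero, ← norm_ne_zero_iff, hF.norm_map]
        exact norm_ne_zero_iff.2 hw0
      by_contra hv
      refine hcon _ (sub_ne_zero.2 (Ne.symm hv)) ?_
      rw [inner_sub_right, inner_smul_right, div_mul_cancel₀ _ hz, sub_self]
    have : (2 : Cardinal) ≤ 1 := hdim.trans hle
    norm_num at this
  set y := F (w + W x) with hy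
  have hyR := rel_map F (w + W x)
  have hux : ∀ u, ‖⟪u, x⟫_ℂ‖ ≤ ‖⟪u, y⟫_ℂ‖ := fun u => by
    have := hF.rel_inner_le (hW u) hyR
    rwa [inner_add_right, hw', zero_add, W.inner_map_map] at this
  have hwy := hF.rel_inner_le (rel_map F w) hyR
  rw [inner_add_right, inner_eq_zero_symm.1 (hw' x), add_zero] at hwy
  have hy0 : ⟪y, y⟫_ℂ ≠ 0 := by
    rw [inner_self_ne_zero]
    intro h0
    have := hux x
    rw [h0, inner_zero_right, norm_zero] at this
    exact inner_self_ne_zero.2 hx0 (norm_le_zero_iff.1 this)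
  have hxy : x = (⟪y, x⟫_ℂ / ⟪y, y⟫_ℂ) • y := by
    set u := x - (⟪y, x⟫_ℂ / ⟪y, y⟫_ℂ) • y with hu
    have hyu : ⟪y, u⟫_ℂ = 0 := by
      rw [hu, inner_sub_right, inner_smul_right, div_mul_cancel₀ _ hy0, sub_self]
    have huy := inner_eq_zero_symm.1 hyu
    have hux0 := hux u
    rw [huy, norm_zero] at hux0
    have huu : ⟪u, u⟫_ℂ = 0 := by
      nth_rewrite 2 [hu]
      rw [inner_sub_right, inner_smul_right, huy, norm_le_zero_iff.1 hux0]
      simp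
    exact sub_eq_zero.1 (inner_self_eq_zero.1 huu)
  have hc : ⟪y, x⟫_ℂ / ⟪y, y⟫_ℂ ≠ 0 := by
    intro h0
    rw [h0, zero_smul] at hxy
    exact hx0 hxy
  rw [hxy, inner_smul_right] at hx
  rw [← hy, (mul_eq_zero.1 hx).resolve_left hc, norm_zero] at hwy
  exact inner_self_ne_zero.2 hw0 (norm_le_zero_iff.1 hwy)

/-- `F` agrees up to phases with a linear isometric equivalence. -/
lemma exists_linearIsometryEquiv (hF : OverlapIncreasing F) (hdim : 2 ≤ Module.rank ℂ H)
    (h : ∀ i, PhaseRel F (e' i) (b i))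
    (hp : ∀ i, i ≠ o → ∀ x y : ℂ, PhaseRel F (x • e' o + y • e' i) (x • b o + y • b i)) :
    ∃ U : H ≃ₗᵢ[ℂ] H, ∀ x, PhaseRel F x (U x) := by
  obtain ⟨W, hW⟩ := hF.exists_linearIsometry h hp
  let E := LinearIsometryEquiv.ofSurjective W (hF.surjective_of_rel hdim W hW)
  refine ⟨E.symm, fun x => ?_⟩
  have := hW (E.symm x)
  rwa [show W (E.symm x) = x from E.apply_symm_apply x] at this

/-- Coordinatewise complex conjugation with respect to a Hilbert basis. -/
lemma _root_.HilbertBasis.exists_conj (b : HilbertBasis ι ℂ H) :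
    ∃ C : H → H, (∀ x y, C (x + y) = C x + C y) ∧ (∀ (c : ℂ) x, C (c • x) = conj c • C x) ∧
      (∀ x y, ⟪C x, C y⟫_ℂ = conj ⟪x, y⟫_ℂ) ∧ (∀ x, C (C x) = x) ∧ ∀ i, C (b i) = b i := by
  classical
  refine ⟨fun x => b.repr.symm (star (b.repr x)), fun x y => ?_, fun c x => ?_, fun x y => ?_,
    fun x => ?_, fun i => ?_⟩
  · simp
  · simp [star_smul]
  · rw [b.repr.symm.inner_map_map, ← b.repr.inner_map_map x y, lp.inner_eq_tsum, lp.inner_eq_tsum]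
    rw [Complex.conj_tsum]
    simp
  · simp
  · simp only [b.repr_self]
    rw [← b.repr_symm_single i]
    congr 1
    ext j
    by_cases hj : j = i
    · subst hj
      simp
    · simp [hj]

end Basis

section Wigner

lemma conj_comp (hF : OverlapIncreasing F) {C : H → H} (hCs : ∀ (c : ℂ) x, C (c • x) = conj c • C x)
    (hCi : ∀ x y, ⟪C x, C y⟫_ℂ = conj ⟪x, y⟫_ℂ) (hCC : ∀ x, C (C x) = x) :
    OverlapIncreasing (C ∘ F) where
  norm_map v := by
    rw [← hF.norm_map v, norm_eq_sqrt_re_inner (𝕜 := ℂ), norm_eq_sqrt_re_inner (𝕜 := ℂ) (F v),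
      Function.comp_apply, hCi, RCLike.conj_re]
  norm_inner_le v w := by
    rw [Function.comp_apply, Function.comp_apply, hCi, RCLike.norm_conj]
    exact hF.norm_inner_le v w
  exists_phase w := by
    obtain ⟨v, c, hc, h⟩ := hF.exists_phase (C w)
    refine ⟨v, conj c, by rw [RCLike.norm_conj, hc], ?_⟩
    rw [Function.comp_apply, ← hCs, ← h, hCC]

lemma _root_.PhaseRel.conj_comp {C : H → H} (hCs : ∀ (c : ℂ) x, C (c • x) = conj c • C x)
    {v w : H} (h : PhaseRel F v w) : PhaseRel (C ∘ F) v (C w) := by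
  obtain ⟨c, hc, rfl⟩ := h
  exact ⟨conj c, by rw [RCLike.norm_conj, hc], hCs c _⟩

lemma _root_.HilbertBasis.exists_rephase {ι : Type*} (b : HilbertBasis ι ℂ H) {t : ι → ℂ}
    (ht : ∀ i, ‖t i‖ = 1) : ∃ b₂ : HilbertBasis ι ℂ H, ∀ i, b₂ i = t i • b i := by
  have ht0 : ∀ i, t i ≠ 0 := fun i h0 => by
    have := ht i
    simp [h0] at this
  have hon : Orthonormal ℂ (fun i => t i • b i) := by
    refine ⟨fun i => by rw [norm_smul, ht, b.orthonormal.1, one_mul], fun i j hij => ?_⟩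
    simp only [inner_smul_left, inner_smul_right, b.orthonormal.2 hij, mul_zero]
  have hbot : (Submodule.span ℂ (Set.range fun i => t i • b i))ᗮ = ⊥ := by
    rw [Submodule.eq_bot_iff]
    intro x hx
    apply b.repr.injective
    ext i
    have := (Submodule.mem_orthogonal _ _).1 hx _ (Submodule.subset_span ⟨i, rfl⟩)
    rw [inner_smul_left, mul_eq_zero] at this
    rw [b.repr_apply_apply, this.resolve_left (by simpa using ht0 i)]
    simp
  exact ⟨HilbertBasis.mkOfOrthogonalEqBot hon hbot, fun i => by simp⟩

/-- A basis rephased so that sums with a fixed basis vector lift to sums. -/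
lemma exists_hilbertBasis_rel_add (hF : OverlapIncreasing F) [Nontrivial H] :
    ∃ (ι : Set H) (b : HilbertBasis ι ℂ H) (o : ι) (e' : ι → H),
      (∀ i, PhaseRel F (e' i) (b i)) ∧ ∀ i, i ≠ o → PhaseRel F (e' o + e' i) (b o + b i) := by
  obtain ⟨ι, b, -⟩ := exists_hilbertBasis ℂ H
  obtain ⟨o⟩ : Nonempty ι := by
    by_contra hι
    rw [not_nonempty_iff] at hι
    obtain ⟨x, hx⟩ := exists_ne (0 : H)
    exact hx (b.repr.injective (by ext i; exact isEmptyElim i))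
  choose e' he' using fun i => hF.rel_surj (b i)
  have hpair : ∀ i, i ≠ o → PairLift F (e' o) (e' i) (b o) (b i) := fun i hi =>
    ⟨orthonormal_pair (b.orthonormal.1 o) (b.orthonormal.1 i) (b.orthonormal.2 (Ne.symm hi)),
      he' o, he' i⟩
  have ht : ∀ i, ∃ t : ℂ, ‖t‖ = 1 ∧ (i = o → t = 1) ∧
      (i ≠ o → PhaseRel F (e' o + e' i) (b o + t • b i)) := fun i => by
    by_cases hi : i = o
    · exact ⟨1, by simp, fun _ => rfl, fun h => absurd hi h⟩
    · obtain ⟨t, ht, ht'⟩ := (hpair i hi).exists_rel hF (s := 1) (by simp)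
      exact ⟨t, ht, fun h => absurd h hi, fun _ => by simpa using ht'⟩
  choose t ht hto hti using ht
  obtain ⟨b₂, hb₂⟩ := b.exists_rephase ht
  refine ⟨ι, b₂, o, e', fun i => ?_, fun i hi => ?_⟩
  · rw [hb₂]
    simpa using hF.rel_smul (he' i) (c := 1) (d := t i) (by simp [ht])
  · rw [hb₂, hb₂, hto o rfl, one_smul]
    exact hti i hi

lemma exists_common_sign (hF : OverlapIncreasing F) {ι : Type*} {b : HilbertBasis ι ℂ H} {o : ι}
    {e' : ι → H} (h : ∀ i, PhaseRel F (e' i) (b i))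
    (hadd : ∀ i, i ≠ o → PhaseRel F (e' o + e' i) (b o + b i)) :
    ∃ z : ℂ, (z = Complex.I ∨ z = -Complex.I) ∧ ∀ i, i ≠ o →
      PhaseRel F (e' o - e' i) (b o - b i) ∧
      PhaseRel F (e' o + Complex.I • e' i) (b o + z • b i) ∧
      PhaseRel F (e' o - Complex.I • e' i) (b o - z • b i) := by
  have hpair : ∀ i, i ≠ o → PairLift F (e' o) (e' i) (b o) (b i) := fun i hi =>
    ⟨orthonormal_pair (b.orthonormal.1 o) (b.orthonormal.1 i) (b.orthonormal.2 (Ne.symm hi)),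
      h o, h i⟩
  by_cases hex : ∃ j, j ≠ o
  · obtain ⟨j, hj⟩ := hex
    obtain ⟨z, hz, -, hzj, -⟩ := (hpair j hj).exists_sign hF (hadd j hj)
    refine ⟨z, hz, fun i hi => ?_⟩
    obtain ⟨y, -, hy⟩ := (hpair i hi).exists_sign hF (hadd i hi)
    suffices z = y by
      rw [this]
      exact hy
    by_cases hij : j = i
    · subst hij
      exact (hpair j hj).unique hzj hy.2.1
    · have hT : TripleLift F (e' o) (e' j) (e' i) (b o) (b j) (b i) :=
        ⟨orthonormal_triple (b.orthonormal.1 o) (b.orthonormal.1 j) (b.orthonormal.1 i)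
          (b.orthonormal.2 (Ne.symm hj)) (b.orthonormal.2 (Ne.symm hi)) (b.orthonormal.2 hij),
          h o, h j, h i⟩
      exact hT.sign_eq hF (hadd j hj) (hadd i hi) hzj hy.2.1
  · push Not at hex
    exact ⟨Complex.I, Or.inl rfl, fun i hi => absurd (hex i) hi⟩

/-- Wigner's theorem for overlap-increasing maps: up to phases such a map is unitary or
antiunitary. -/
theorem exists_unitary_or_antiunitary (hF : OverlapIncreasing F) (hdim : 2 ≤ Module.rank ℂ H) :
    ∃ U : H → H, (∀ x y, U (x + y) = U x + U y) ∧ (∀ x, ‖U x‖ = ‖x‖) ∧ Function.Surjective U ∧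
      ((∀ (c : ℂ) x, U (c • x) = c • U x) ∨ ∀ (c : ℂ) x, U (c • x) = conj c • U x) ∧
      ∀ x, PhaseRel F x (U x) := by
  have : Nontrivial H := by
    rw [← rank_pos_iff_nontrivial (R := ℂ)]
    exact lt_of_lt_of_le (by norm_num) hdim
  obtain ⟨ι, b, o, e', h, hadd⟩ := hF.exists_hilbertBasis_rel_add
  have hpair : ∀ i, i ≠ o → Orthonormal ℂ ![b o, b i] := fun i hi =>
    orthonormal_pair (b.orthonormal.1 o) (b.orthonormal.1 i) (b.orthonormal.2 (Ne.symm hi))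
  obtain ⟨z, rfl | rfl, hz⟩ := hF.exists_common_sign h hadd
  · obtain ⟨U, hU⟩ := hF.exists_linearIsometryEquiv hdim h fun i hi =>
      PairLift.rel_of_rel_four ⟨hpair i hi, h o, h i⟩ hF (hadd i hi) (hz i hi).1 (hz i hi).2.1
        (hz i hi).2.2
    exact ⟨U, map_add U, U.norm_map, U.surjective, Or.inl fun c x => map_smul U c x, hU⟩
  · obtain ⟨C, hCa, hCs, hCi, hCC, hCb⟩ := b.exists_conj
    have hG := hF.conj_comp hCs hCi hCC
    have hCneg : ∀ x, C (-x) = -C x := fun x => by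
      have := hCs (-1) x
      simpa using this
    have key : ∀ {v w : H}, PhaseRel F v w → PhaseRel (C ∘ F) v (C w) := fun h =>
      h.conj_comp hCs
    have h' : ∀ i, PhaseRel (C ∘ F) (e' i) (b i) := fun i => by simpa [hCb] using key (h i)
    obtain ⟨U, hU⟩ := hG.exists_linearIsometryEquiv hdim h' fun i hi =>
      PairLift.rel_of_rel_four ⟨hpair i hi, h' o, h' i⟩ hG
        (by simpa [hCa, hCb] using key (hadd i hi))
        (by simpa [sub_eq_add_neg, hCa, hCb, hCneg] using key (hz i hi).1)
        (by simpa [hCa, hCb, hCs, hCneg] using key (hz i hi).2.1)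
        (by simpa [sub_eq_add_neg, hCa, hCb, hCs, hCneg] using key (hz i hi).2.2)
    refine ⟨fun x => C (U x), fun x y => by simp only [map_add, hCa], fun x => ?_, fun y => ?_,
      Or.inr fun c x => by simp only [map_smul, hCs], fun x => ?_⟩
    · rw [norm_eq_sqrt_re_inner (𝕜 := ℂ), hCi, RCLike.conj_re, ← norm_eq_sqrt_re_inner, U.norm_map]
    · obtain ⟨x, hx⟩ := U.surjective (C y)
      exact ⟨x, by simp only [hx, hCC]⟩
    · obtain ⟨c, hc, hcx⟩ := hU x
      refine ⟨conj c, by rw [RCLike.norm_conj, hc], ?_⟩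
      simp only [hcx, hCs, Function.comp_apply, hCC]

end Wigner

end OverlapIncreasing

section RankOne

lemma rankOneProj_apply (v x : H) : rankOneProj v x = ⟪v, x⟫_ℂ • v := rfl

lemma rankOneProj_smul {c : ℂ} (hc : ‖c‖ = 1) (v : H) : rankOneProj (c • v) = rankOneProj v := by
  ext x
  rw [rankOneProj_apply, rankOneProj_apply, inner_smul_left, smul_smul, mul_right_comm,
    Complex.conj_mul', hc]
  simp

lemma isRankOneProjection_rankOneProj {v : H} (hv : ‖v‖ = 1) :
    IsRankOneProjection (rankOneProj v) := by
  have hvv : ⟪v, v⟫_ℂ = 1 := by simp [inner_self_eq_norm_sq_to_K, hv]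
  refine ⟨?_, ?_, ?_⟩
  · rw [ContinuousLinearMap.isSelfAdjoint_iff_isSymmetric]
    intro x y
    simp only [ContinuousLinearMap.coe_coe, rankOneProj_apply, inner_smul_left, inner_smul_right,
      inner_conj_symm]
    ring
  · ext x
    simp only [ContinuousLinearMap.comp_apply, rankOneProj_apply, inner_smul_right, hvv, mul_one]
  · have : LinearMap.range (rankOneProj v : H →ₗ[ℂ] H) = Submodule.span ℂ {v} := by
      ext y
      rw [Submodule.mem_span_singleton]
      constructor
      · rintro ⟨x, rfl⟩
        exact ⟨_, rfl⟩
      · rintro ⟨a, rfl⟩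
        refine ⟨a • v, ?_⟩
        rw [ContinuousLinearMap.coe_coe, rankOneProj_apply, inner_smul_right, hvv, mul_one]
    rw [this]
    exact finrank_span_singleton (by rintro rfl; simp at hv)

lemma IsRankOneProjection.exists_eq {P : H →L[ℂ] H} (hP : IsRankOneProjection P) :
    ∃ v : H, ‖v‖ = 1 ∧ P = rankOneProj v := by
  obtain ⟨hsa, hid, hfr⟩ := hP
  obtain ⟨⟨w, y, hy⟩, hw0, hw⟩ := finrank_eq_one_iff'.1 hfr
  have hw0' : w ≠ 0 := fun h => hw0 (Subtype.ext h)
  have hPP : ∀ x, P (P x) = P x := fun x => congrArg (fun T : H →L[ℂ] H => T x) hid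
  have hPw : P w = w := by
    rw [← hy]
    exact hPP y
  have hv1 : ‖((‖w‖⁻¹ : ℝ) : ℂ) • w‖ = 1 := by
    rw [norm_smul, Complex.norm_real, norm_inv, norm_norm,
      inv_mul_cancel₀ (norm_ne_zero_iff.2 hw0')]
  have hPv : P (((‖w‖⁻¹ : ℝ) : ℂ) • w) = ((‖w‖⁻¹ : ℝ) : ℂ) • w := by rw [map_smul, hPw]
  refine ⟨((‖w‖⁻¹ : ℝ) : ℂ) • w, hv1, ?_⟩
  have hspan : ∀ x, ∃ r : ℂ, P x = r • (((‖w‖⁻¹ : ℝ) : ℂ) • w) := fun x => by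
    obtain ⟨c, hc⟩ := hw ⟨P x, x, rfl⟩
    refine ⟨c * ‖w‖, ?_⟩
    rw [smul_smul, mul_assoc, ← Complex.ofReal_mul, mul_inv_cancel₀ (norm_ne_zero_iff.2 hw0'),
      Complex.ofReal_one, mul_one]
    exact (congrArg Subtype.val hc).symm
  generalize ((‖w‖⁻¹ : ℝ) : ℂ) • w = v at *
  have hvv : ⟪v, v⟫_ℂ = 1 := by simp [inner_self_eq_norm_sq_to_K, hv1]
  ext x
  obtain ⟨r, hr⟩ := hspan x
  have hsym : ⟪P v, x⟫_ℂ = ⟪v, P x⟫_ℂ :=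
    ContinuousLinearMap.isSelfAdjoint_iff_isSymmetric.1 hsa v x
  rw [hPv, hr, inner_smul_right, hvv, mul_one] at hsym
  rw [hr, rankOneProj_apply, hsym]

lemma sq_norm_sub_inner_smul {u : H} (hu : ‖u‖ = 1) (x : H) :
    ‖x - ⟪u, x⟫_ℂ • u‖ ^ 2 = ‖x‖ ^ 2 - ‖⟪u, x⟫_ℂ‖ ^ 2 := by
  rw [norm_sub_sq (𝕜 := ℂ), inner_smul_right, ← inner_conj_symm x u, RCLike.mul_conj, norm_smul, hu]
  norm_cast
  ring

lemma sq_norm_rankOneProj_sub_ge {u w : H} (hu : ‖u‖ = 1) (hw : ‖w‖ = 1) :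
    1 - ‖⟪u, w⟫_ℂ‖ ^ 2 ≤ ‖rankOneProj u - rankOneProj w‖ ^ 2 := by
  have hww : ⟪w, w⟫_ℂ = 1 := by simp [inner_self_eq_norm_sq_to_K, hw]
  have := (rankOneProj u - rankOneProj w).le_opNorm w
  rw [hw, mul_one, sub_apply, rankOneProj_apply, rankOneProj_apply, hww,
    one_smul, norm_sub_rev] at this
  have h2 := pow_le_pow_left₀ (norm_nonneg _) this 2
  rwa [sq_norm_sub_inner_smul hu, hw, one_pow] at h2

lemma sq_norm_rankOneProj_sub_le {u w : H} (hu : ‖u‖ = 1) (hw : ‖w‖ = 1) :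
    ‖rankOneProj u - rankOneProj w‖ ^ 2 ≤ 1 - ‖⟪u, w⟫_ℂ‖ ^ 2 := by
  have hc : ‖⟪u, w⟫_ℂ‖ ≤ 1 := by
    have := norm_inner_le_norm (𝕜 := ℂ) u w
    rwa [hu, hw, one_mul] at this
  have hc2 : 0 ≤ 1 - ‖⟪u, w⟫_ℂ‖ ^ 2 := sub_nonneg.2 (pow_le_one₀ (norm_nonneg _) hc)
  have huu : ⟪u, u⟫_ℂ = 1 := by simp [inner_self_eq_norm_sq_to_K, hu]
  suffices ‖rankOneProj u - rankOneProj w‖ ≤ √(1 - ‖⟪u, w⟫_ℂ‖ ^ 2) by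
    have := pow_le_pow_left₀ (norm_nonneg _) this 2
    rwa [Real.sq_sqrt hc2] at this
  refine ContinuousLinearMap.opNorm_le_bound _ (Real.sqrt_nonneg _) fun x => ?_
  refine (pow_le_pow_iff_left₀ (norm_nonneg _) (by positivity) two_ne_zero).1 ?_
  rw [mul_pow, Real.sq_sqrt hc2, sub_apply, rankOneProj_apply,
    rankOneProj_apply]
  have hcs := pow_le_pow_left₀ (norm_nonneg _)
    (norm_inner_le_norm (𝕜 := ℂ) (w - ⟪u, w⟫_ℂ • u) (x - ⟪u, x⟫_ℂ • u)) 2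
  rw [mul_pow, sq_norm_sub_inner_smul hu, sq_norm_sub_inner_smul hu, hw, one_pow] at hcs
  have hin : ⟪w - ⟪u, w⟫_ℂ • u, x - ⟪u, x⟫_ℂ • u⟫_ℂ = ⟪w, x⟫_ℂ - conj ⟪u, w⟫_ℂ * ⟪u, x⟫_ℂ := by
    simp only [inner_sub_left, inner_sub_right, inner_smul_left, inner_smul_right, huu]
    rw [← inner_conj_symm w u]
    ring
  rw [hin] at hcs
  rw [norm_sub_sq (𝕜 := ℂ), inner_smul_left, inner_smul_right, norm_smul, norm_smul, hu, hw]
  generalize ⟪w, x⟫_ℂ = d at *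
  generalize ⟪u, x⟫_ℂ = a at *
  generalize ⟪u, w⟫_ℂ = c at *
  simp only [Complex.sq_norm, Complex.normSq_apply, Complex.sub_re, Complex.sub_im, Complex.mul_re,
    Complex.mul_im, Complex.conj_re, Complex.conj_im, RCLike.re_to_complex, mul_one] at hcs ⊢
  nlinarith

lemma exists_phase_of_rankOneProj_eq {u w : H} (hu : ‖u‖ = 1) (hw : ‖w‖ = 1)
    (h : rankOneProj u = rankOneProj w) : ∃ c : ℂ, ‖c‖ = 1 ∧ w = c • u := by
  have hww : ⟪w, w⟫_ℂ = 1 := by simp [inner_self_eq_norm_sq_to_K, hw]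
  have := congrArg (fun T : H →L[ℂ] H => T w) h
  simp only [rankOneProj_apply, hww, one_smul] at this
  refine ⟨⟪u, w⟫_ℂ, ?_, this.symm⟩
  have hn := congrArg norm this
  rwa [norm_smul, hu, hw, mul_one] at hn

end RankOne

/-- A map of unit vectors not decreasing overlaps and surjective up to phases extends
homogeneously. -/
lemma overlapIncreasing_of_unit {G : H → H} (hn : ∀ v, ‖v‖ = 1 → ‖G v‖ = 1)
    (hi : ∀ v w, ‖v‖ = 1 → ‖w‖ = 1 → ‖⟪v, w⟫_ℂ‖ ≤ ‖⟪G v, G w⟫_ℂ‖)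
    (hs : ∀ w, ‖w‖ = 1 → ∃ v, ‖v‖ = 1 ∧ ∃ c : ℂ, ‖c‖ = 1 ∧ w = c • G v) :
    OverlapIncreasing fun v : H => (‖v‖ : ℂ) • G ((‖v‖⁻¹ : ℂ) • v) := by
  have hunit : ∀ v : H, v ≠ 0 → ‖(‖v‖⁻¹ : ℂ) • v‖ = 1 := fun v hv => by
    rw [norm_smul, norm_inv, Complex.norm_real, norm_norm, inv_mul_cancel₀ (norm_ne_zero_iff.2 hv)]
  refine ⟨fun v => ?_, fun v w => ?_, fun w => ?_⟩
  · by_cases hv : v = 0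
    · simp [hv]
    · rw [norm_smul, hn _ (hunit v hv), Complex.norm_real, norm_norm, mul_one]
  · by_cases hv : v = 0
    · simp [hv]
    by_cases hw : w = 0
    · simp [hw]
    have := hi _ _ (hunit v hv) (hunit w hw)
    simp only [inner_smul_left, inner_smul_right, norm_mul, RCLike.norm_conj, norm_inv,
      Complex.norm_real, norm_norm] at this ⊢
    have hv' : 0 < ‖v‖ := norm_pos_iff.2 hv
    have hw' : 0 < ‖w‖ := norm_pos_iff.2 hw
    calc ‖⟪v, w⟫_ℂ‖ = ‖w‖ * (‖v‖ * (‖w‖⁻¹ * (‖v‖⁻¹ * ‖⟪v, w⟫_ℂ‖))) := by field_simp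
      _ ≤ _ := by gcongr
  · by_cases hw : w = 0
    · exact ⟨0, 1, by simp, by simp [hw]⟩
    obtain ⟨v, hv, c, hc, hvc⟩ := hs _ (hunit w hw)
    have hw' : (‖w‖ : ℂ) ≠ 0 := by simpa using hw
    refine ⟨(‖w‖ : ℂ) • v, c, hc, ?_⟩
    have hnv : ‖(‖w‖ : ℂ) • v‖ = ‖w‖ := by simp [norm_smul, hv]
    rw [hnv, smul_smul (‖w‖⁻¹ : ℂ), inv_mul_cancel₀ hw', one_smul, smul_comm, ← hvc, smul_smul,
      mul_inv_cancel₀ hw', one_smul]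

/-- Theorem 1.4. If `dim H ≥ 2` and `φ` is a surjective map on the set of
rank-one projections with `‖φ(P) − φ(Q)‖ ≤ ‖P − Q‖` for all `P, Q`, then `φ` is a
Wigner symmetry. -/
theorem surjective_nonexpansive_is_wigner
    (hdim : 2 ≤ Module.rank ℂ H)
    (φ : {P : H →L[ℂ] H // IsRankOneProjection P} → {P : H →L[ℂ] H // IsRankOneProjection P})
    (hsurj : Function.Surjective φ)
    (hne : ∀ P Q : {P : H →L[ℂ] H // IsRankOneProjection P},
      ‖(φ P).1 - (φ Q).1‖ ≤ ‖P.1 - Q.1‖) :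
    IsWignerSymmetry φ := by
  have hG : ∀ v : H, ∃ w : H, ‖v‖ = 1 → ‖w‖ = 1 ∧
      ∀ P : {P : H →L[ℂ] H // IsRankOneProjection P}, P.1 = rankOneProj v →
        (φ P).1 = rankOneProj w := fun v => by
    by_cases hv : ‖v‖ = 1
    · obtain ⟨w, hw, hφ⟩ := (φ ⟨_, isRankOneProjection_rankOneProj hv⟩).2.exists_eq
      refine ⟨w, fun _ => ⟨hw, fun P hP => ?_⟩⟩
      obtain rfl : P = ⟨_, isRankOneProjection_rankOneProj hv⟩ := Subtype.ext hP
      exact hφ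
    · exact ⟨0, fun h => absurd h hv⟩
  choose G hG using hG
  have hF := overlapIncreasing_of_unit (G := G) (fun v hv => (hG v hv).1)
    (fun v w hv hw => by
      have h := hne ⟨_, isRankOneProjection_rankOneProj hv⟩ ⟨_, isRankOneProjection_rankOneProj hw⟩
      rw [(hG v hv).2 _ rfl, (hG w hw).2 _ rfl] at h
      have h₁ := sq_norm_rankOneProj_sub_ge (hG v hv).1 (hG w hw).1
      have h₂ := sq_norm_rankOneProj_sub_le hv hw
      have h₃ := pow_le_pow_left₀ (norm_nonneg _) h 2
      exact (pow_le_pow_iff_left₀ (norm_nonneg _) (norm_nonneg _) two_ne_zero).1 (by linarith))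
    (fun w hw => by
      obtain ⟨P, hP⟩ := hsurj ⟨_, isRankOneProjection_rankOneProj hw⟩
      obtain ⟨v, hv, hPv⟩ := P.2.exists_eq
      refine ⟨v, hv, exists_phase_of_rankOneProj_eq (hG v hv).1 hw ?_⟩
      rw [← (hG v hv).2 P hPv, hP])
  obtain ⟨U, hadd, hnorm, hUs, hlin, hrel⟩ := hF.exists_unitary_or_antiunitary hdim
  refine ⟨U, hadd, hnorm, hUs, hlin, fun v hv P hP => ?_⟩
  obtain ⟨c, hc, hUv⟩ := hrel v
  rw [hUv, rankOneProj_smul hc, (hG v hv).2 P hP]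
  simp [hv]
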